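/- arXiv:2505.11091 — 2 statements merged into one kernel-verified Lean document; each statement's English description precedes it below -/
import Mathlib

section
/- Let d ≥ 2 and let S ⊆ ℕ^d be a generalized numerical semigroup with embedding dimension 2d+1. Then S is symmetric if and only if S has a unique maximal gap with respect to the componentwise order (i.e., |FA(S)| = 1). -/
/-- The set of pseudo-Frobenius elements of a submonoid of ℕ^d. -/
def PF {d : ℕ} (S : AddSubmonoid (Fin d → ℕ)) : Set (Fin d → ℕ) :=
  {h | h ∉ S ∧ ∀ s ∈ S, s ≠ 0 → h + s ∈ S}

/-- Maximal gaps of a submonoid of ℕ^d, w.r.t. the componentwise order. -/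
def FA {d : ℕ} (S : AddSubmonoid (Fin d → ℕ)) : Set (Fin d → ℕ) :=
  {h | h ∉ S ∧ ∀ g, g ∉ S → h ≤ g → g = h}

section generators

variable {M : Type*} [AddCommMonoid M]

theorem exists_generator_add {A : Set M} {x : M} (hx : x ∈ AddSubmonoid.closure A) (h0 : x ≠ 0) :
    ∃ a ∈ A, a ≠ 0 ∧ ∃ y ∈ AddSubmonoid.closure A, x = a + y := by
  induction hx using AddSubmonoid.closure_induction with
  | mem x hx => exact ⟨x, hx, h0, 0, zero_mem _, (add_zero x).symm⟩
  | zero => exact absurd rfl h0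
  | add x y hx hy ihx ihy =>
    by_cases hx0 : x = 0
    · subst hx0
      simpa using ihy (by simpa using h0)
    · obtain ⟨a, ha, ha0, z, hz, rfl⟩ := ihx hx0
      exact ⟨a, ha, ha0, z + y, add_mem hz hy, add_assoc _ _ _⟩

end generators

section numerical

/-- A numerical semigroup generated by two elements is symmetric. -/
theorem sub_mem_closure_pair {a b g u : ℕ}
    (hg : g ∉ AddSubmonoid.closure ({a, b} : Set ℕ))
    (hgt : ∀ n, g < n → n ∈ AddSubmonoid.closure ({a, b} : Set ℕ))
    (hu : u ∉ AddSubmonoid.closure ({a, b} : Set ℕ)) :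
    g - u ∈ AddSubmonoid.closure ({a, b} : Set ℕ) := by
  have hmem : ∀ n, n ∈ AddSubmonoid.closure ({a, b} : Set ℕ) ↔ ∃ p q : ℕ, p * a + q * b = n := by
    intro n
    simp [AddSubmonoid.mem_closure_pair]
  have h1 : 1 ∉ AddSubmonoid.closure ({a, b} : Set ℕ) := fun h =>
    hg (by simpa using nsmul_mem h g)
  have ha1 : a ≠ 1 := fun h => h1 (AddSubmonoid.subset_closure (by simp [h]))
  have hb1 : b ≠ 1 := fun h => h1 (AddSubmonoid.subset_closure (by simp [h]))
  have hco : Nat.Coprime a b := by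
    have hdvd : ∀ n, g < n → a.gcd b ∣ n := by
      intro n hn
      obtain ⟨p, q, rfl⟩ := (hmem n).1 (hgt n hn)
      exact dvd_add (dvd_mul_of_dvd_right (Nat.gcd_dvd_left a b) _)
        (dvd_mul_of_dvd_right (Nat.gcd_dvd_right a b) _)
    exact Nat.dvd_one.1 ((Nat.dvd_add_right (hdvd (g + 1) (by omega))).1 (hdvd (g + 2) (by omega)))
  have ha : 1 < a := by
    rcases Nat.eq_zero_or_pos a with rfl | h
    · simp at hco; omega
    · omega
  have hb : 1 < b := by
    rcases Nat.eq_zero_or_pos b with rfl | h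
    · simp at hco; omega
    · omega
  have hgeq : g = a * b - a - b :=
    IsGreatest.unique (a := g) ⟨hg, fun n hn => not_lt.1 fun h => (show n ∉ _ from hn) (hgt n h)⟩
      (frobeniusNumber_pair hco ha hb)
  have hab : a + b ≤ a * b := by nlinarith
  obtain ⟨α, hα, hmod⟩ : ∃ α < b, α * a ≡ u [MOD b] := by
    obtain ⟨c, hc⟩ := Nat.exists_mul_mod_eq_one_of_coprime hco hb
    refine ⟨c * u % b, Nat.mod_lt _ (by omega), ?_⟩
    have : a * c ≡ 1 [MOD b] := by rw [Nat.ModEq, hc.2, Nat.mod_eq_of_lt hb]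
    calc c * u % b * a ≡ c * u * a [MOD b] := (Nat.mod_modEq _ _).mul_right _
      _ = a * c * u := by ring
      _ ≡ 1 * u [MOD b] := this.mul_right _
      _ = u := one_mul u
  have hlt : u < α * a := by
    by_contra! hle
    obtain ⟨q, hq⟩ := (Nat.modEq_iff_dvd' hle).1 hmod
    exact hu ((hmem u).2 ⟨α, q, by rw [mul_comm q]; omega⟩)
  obtain ⟨q, hq⟩ := (Nat.modEq_iff_dvd' hlt.le).1 hmod.symm
  have hq0 : q ≠ 0 := by rintro rfl; simp at hq; omega
  obtain ⟨q, rfl⟩ := Nat.exists_eq_succ_of_ne_zero hq0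
  obtain ⟨β, hβ⟩ := Nat.exists_eq_add_of_lt hα
  refine (hmem _).2 ⟨β, q, ?_⟩
  have h2 : α * a = u + b * (q + 1) := by rw [← Nat.succ_eq_add_one, ← hq]; omega
  have h3 : a * b = α * a + β * a + a := by rw [hβ]; ring
  have h4 : b * (q + 1) = q * b + b := by ring
  omega

theorem one_mem_closure_of_card_le_one {B : Finset ℕ} (hB : B.card ≤ 1) {n : ℕ}
    (hn : n ∈ AddSubmonoid.closure (B : Set ℕ)) (hn' : n + 1 ∈ AddSubmonoid.closure (B : Set ℕ)) :
    1 ∈ AddSubmonoid.closure (B : Set ℕ) := by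
  obtain ⟨c, hc⟩ := Finset.card_le_one_iff_subset_singleton.1 hB
  have hle : AddSubmonoid.closure (B : Set ℕ) ≤ AddSubmonoid.closure {c} :=
    AddSubmonoid.closure_mono (by exact_mod_cast hc)
  have hdvd : ∀ m ∈ AddSubmonoid.closure (B : Set ℕ), c ∣ m := by
    intro m hm
    obtain ⟨k, hk⟩ := AddSubmonoid.mem_closure_singleton.1 (hle hm)
    exact ⟨k, by rw [← hk, smul_eq_mul, mul_comm]⟩
  obtain rfl : c = 1 := Nat.dvd_one.1 ((Nat.dvd_add_right (hdvd n hn)).1 (hdvd _ hn'))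
  obtain ⟨a, ha, -⟩ := exists_generator_add hn' (by omega)
  have := Finset.mem_singleton.1 (hc ha)
  exact AddSubmonoid.subset_closure (this ▸ ha)

end numerical

section plane

variable {d : ℕ}

/-- The multiples of the unit vector of the axis `i` lying in `S`, as a submonoid of `ℕ`. -/
def axisMonoid (S : AddSubmonoid (Fin d → ℕ)) (i : Fin d) : AddSubmonoid ℕ :=
  S.comap (AddMonoidHom.single (fun _ : Fin d => ℕ) i)

theorem mem_axisMonoid {S : AddSubmonoid (Fin d → ℕ)} {i : Fin d} {n : ℕ} :
    n ∈ axisMonoid S i ↔ Pi.single i n ∈ S := Iff.rfl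

/-- The elements of `A` in the plane spanned by the axes `i` and `j` and off the axis `i`;
for `i = j`, the nonzero elements of `A` on the axis `i`. -/
def planeGens (A : Finset (Fin d → ℕ)) (i j : Fin d) : Finset (Fin d → ℕ) :=
  A.filter fun x => x j ≠ 0 ∧ ∀ l, l ≠ i → l ≠ j → x l = 0

theorem mem_planeGens {A : Finset (Fin d → ℕ)} {i j : Fin d} {x : Fin d → ℕ} :
    x ∈ planeGens A i j ↔ x ∈ A ∧ x j ≠ 0 ∧ ∀ l, l ≠ i → l ≠ j → x l = 0 := by
  simp [planeGens]

theorem eq_single_of_forall {i : Fin d} {x : Fin d → ℕ} (h : ∀ l, l ≠ i → x l = 0) :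
    x = Pi.single i (x i) := by
  ext l
  by_cases hl : l = i
  · subst hl; simp
  · simp [hl, h l hl]

theorem single_le_of_le {i : Fin d} {n : ℕ} {x : Fin d → ℕ} (h : n ≤ x i) : Pi.single i n ≤ x := by
  intro l
  by_cases hl : l = i
  · subst hl; simpa using h
  · simp [hl]

theorem eq_single_add_single {i j : Fin d} (hij : i ≠ j) {x : Fin d → ℕ}
    (h : ∀ l, l ≠ i → l ≠ j → x l = 0) : x = Pi.single i (x i) + Pi.single j (x j) := by
  ext l
  by_cases hi : l = i
  · subst hi; simp [hij]
  · by_cases hj : l = j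
    · subst hj; simp [hi]
    · simp [hi, hj, h l hi hj]

theorem disjoint_planeGens (A : Finset (Fin d → ℕ)) (i : Fin d) {j l : Fin d} (hjl : j ≠ l) :
    Disjoint (planeGens A i j) (planeGens A i l) := by
  refine Finset.disjoint_left.2 fun x hx hx' => ?_
  rw [mem_planeGens] at hx hx'
  by_cases hl : l = i
  · exact hx.2.1 (hx'.2.2 j (hl ▸ hjl) hjl)
  · exact hx'.2.1 (hx.2.2 l hl hjl.symm)

theorem sum_card_planeGens_le (A : Finset (Fin d → ℕ)) (i : Fin d) :
    ∑ j, (planeGens A i j).card ≤ A.card := by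
  rw [← Finset.card_biUnion fun j _ l _ h => disjoint_planeGens A i h]
  exact Finset.card_le_card (Finset.biUnion_subset.2 fun j _ => Finset.filter_subset _ _)

variable {S : AddSubmonoid (Fin d → ℕ)} {A : Finset (Fin d → ℕ)}

/-- A nonzero element of the plane spanned by the axes `i ≠ j` splits off a generator of that
plane. -/
theorem exists_planar_generator (hgen : AddSubmonoid.closure (A : Set (Fin d → ℕ)) = S)
    {i j : Fin d} (hij : i ≠ j) {u v : ℕ} (h : Pi.single i u + Pi.single j v ∈ S)
    (h0 : u + v ≠ 0) :
    ∃ p q, p ≤ u ∧ q ≤ v ∧ p + q ≠ 0 ∧ Pi.single i p + Pi.single j q ∈ A ∧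
      Pi.single i (u - p) + Pi.single j (v - q) ∈ S := by
  have hx0 : (Pi.single i u + Pi.single j v : Fin d → ℕ) ≠ 0 := by
    intro h
    have hi := congrFun h i
    have hj := congrFun h j
    simp [hij, hij.symm] at hi hj
    omega
  obtain ⟨a, ha, ha0, y, hy, hay⟩ := exists_generator_add (hgen ▸ h) hx0
  have hl : ∀ l, l ≠ i → l ≠ j → a l = 0 ∧ y l = 0 := by
    intro l hi hj
    have := congrFun hay l
    simp [hi, hj] at this
    omega
  have hi := congrFun hay i
  have hj := congrFun hay j
  simp [hij, hij.symm] at hi hj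
  have haeq := eq_single_add_single hij fun l h h' => (hl l h h').1
  have hyeq := eq_single_add_single hij fun l h h' => (hl l h h').2
  refine ⟨a i, a j, by omega, by omega, ?_, haeq ▸ ha, ?_⟩
  · intro h
    apply ha0
    rw [haeq, show a i = 0 by omega, show a j = 0 by omega]
    simp
  · rw [show u - a i = y i by omega, show v - a j = y j by omega, ← hyeq, ← hgen]
    exact hy

theorem axisMonoid_eq_closure (hgen : AddSubmonoid.closure (A : Set (Fin d → ℕ)) = S)
    (i : Fin d) :
    axisMonoid S i = AddSubmonoid.closure (((planeGens A i i).image (· i) : Finset ℕ) : Set ℕ) := by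
  have hAS : ∀ a ∈ A, a ∈ S := fun a ha => hgen ▸ AddSubmonoid.subset_closure ha
  apply le_antisymm
  · intro n
    induction n using Nat.strong_induction_on with
    | _ n ih =>
      intro hn
      by_cases hn0 : n = 0
      · subst hn0; exact zero_mem _
      obtain ⟨a, ha, ha0, y, hy, hay⟩ := exists_generator_add (hgen ▸ mem_axisMonoid.1 hn)
        (by simpa using hn0)
      have hl : ∀ l, l ≠ i → a l = 0 ∧ y l = 0 := by
        intro l hl
        have := congrFun hay l
        simp [hl] at this
        omega
      have hi := congrFun hay i
      simp at hi
      have haeq := eq_single_of_forall fun l h => (hl l h).1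
      have hai : a i ≠ 0 := fun h => ha0 (by rw [haeq, h]; simp)
      have hyi : y i ∈ axisMonoid S i := by
        rw [mem_axisMonoid, ← eq_single_of_forall fun l h => (hl l h).2, ← hgen]
        exact hy
      rw [hi]
      refine add_mem (AddSubmonoid.subset_closure ?_) (ih _ (by omega) hyi)
      simp only [Finset.coe_image, Set.mem_image, Finset.mem_coe]
      exact ⟨a, mem_planeGens.2 ⟨ha, hai, fun l h _ => (hl l h).1⟩, rfl⟩
  · rw [AddSubmonoid.closure_le]
    intro n hn
    simp only [Finset.coe_image, Set.mem_image, Finset.mem_coe] at hn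
    obtain ⟨a, ha, rfl⟩ := hn
    obtain ⟨ha, -, hl⟩ := mem_planeGens.1 ha
    change Pi.single i (a i) ∈ S
    rw [← eq_single_of_forall fun l h => hl l h h]
    exact hAS a ha

theorem two_le_card_planeGens_self (hgen : AddSubmonoid.closure (A : Set (Fin d → ℕ)) = S)
    {i : Fin d} (h1 : 1 ∉ axisMonoid S i) {n : ℕ} (hn : n ∈ axisMonoid S i)
    (hsucc : n + 1 ∈ axisMonoid S i) : 2 ≤ (planeGens A i i).card := by
  by_contra! hlt
  rw [axisMonoid_eq_closure hgen] at h1 hn hsucc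
  exact h1 (one_mem_closure_of_card_le_one (Finset.card_image_le.trans (by omega)) hn hsucc)

/-- If the unit vector of the axis `i` is not in `S`, the first element of `S` on the line through it
parallel to the axis `j` is a generator. -/
theorem exists_single_one_add_single_mem (hgen : AddSubmonoid.closure (A : Set (Fin d → ℕ)) = S)
    {i j : Fin d} (hij : i ≠ j) (h1 : 1 ∉ axisMonoid S i) {n : ℕ}
    (hn : Pi.single i 1 + Pi.single j n ∈ S) :
    ∃ k ≠ 0, Pi.single i 1 + Pi.single j k ∈ A := by
  induction n using Nat.strong_induction_on with
  | _ n ih =>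
    obtain ⟨p, q, hp, hq, hpq, hA, hS⟩ := exists_planar_generator hgen hij hn (by omega)
    obtain rfl | rfl : p = 0 ∨ p = 1 := by omega
    · exact ih (n - q) (by omega) hS
    · refine ⟨q, ?_, hA⟩
      rintro rfl
      refine h1 (mem_axisMonoid.2 ?_)
      rw [← hgen]
      exact AddSubmonoid.subset_closure (by simpa using hA)

theorem exists_single_add_single_one_mem (hgen : AddSubmonoid.closure (A : Set (Fin d → ℕ)) = S)
    {i j : Fin d} (hij : i ≠ j) {n : ℕ} (hn : Pi.single i n + Pi.single j 1 ∈ S) :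
    ∃ k ≤ n, n - k ∈ axisMonoid S i ∧ Pi.single i k + Pi.single j 1 ∈ A := by
  induction n using Nat.strong_induction_on with
  | _ n ih =>
    obtain ⟨p, q, hp, hq, hpq, hA, hS⟩ := exists_planar_generator hgen hij hn (by omega)
    obtain rfl | rfl : q = 0 ∨ q = 1 := by omega
    · obtain ⟨k, hk, hN, hkA⟩ := ih (n - p) (by omega) hS
      refine ⟨k, by omega, ?_, hkA⟩
      have hpN : p ∈ axisMonoid S i := by
        rw [mem_axisMonoid, ← hgen]
        exact AddSubmonoid.subset_closure (by simpa using hA)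
      have := add_mem hpN hN
      rwa [show p + (n - p - k) = n - k by omega] at this
    · exact ⟨p, hp, mem_axisMonoid.2 (by simpa using hS), hA⟩

theorem two_le_card_planeGens (hgen : AddSubmonoid.closure (A : Set (Fin d → ℕ)) = S)
    {F : Fin d → ℕ} (hbox : ∀ h, h ∉ S → h ≤ F) {i : Fin d} (hi : 1 ∉ axisMonoid S i)
    (j : Fin d) : 2 ≤ (planeGens A i j).card := by
  have hlarge : ∀ x l, F l < x l → x ∈ S := fun x l hl =>
    by_contra fun hx => (hbox x hx l).not_gt hl
  have haxis : ∀ l n, F l < n → n ∈ axisMonoid S l := fun l n hn =>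
    mem_axisMonoid.2 (hlarge _ l (by simpa using hn))
  have hself : ∀ l, 1 ∉ axisMonoid S l → 2 ≤ (planeGens A l l).card := fun l hl =>
    two_le_card_planeGens_self hgen hl (haxis l (F l + 1) (by omega)) (haxis l _ (by omega))
  by_cases hij : i = j
  · exact hij ▸ hself i hi
  by_cases hj : 1 ∈ axisMonoid S j
  · obtain ⟨k, hk, -, hjA⟩ := exists_single_add_single_one_mem hgen hij (n := 0)
      (by simpa using mem_axisMonoid.1 hj)
    obtain rfl : k = 0 := by omega
    obtain ⟨k, hk, hkA⟩ := exists_single_one_add_single_mem hgen hij hi (n := F j + 1)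
      (hlarge _ j (by simp [hij]))
    refine Finset.one_lt_card.2 ⟨_, mem_planeGens.2 ⟨hjA, ?_, ?_⟩, _,
      mem_planeGens.2 ⟨hkA, ?_, ?_⟩, fun h => ?_⟩
    · simp
    · intro l _ hl'; simp [hl']
    · simp [Ne.symm hij, hk]
    · intro l hl hl'; simp [hl, hl']
    · simpa [hij] using congrFun h i
  · refine (hself j hj).trans (Finset.card_le_card fun x hx => ?_)
    rw [mem_planeGens] at hx ⊢
    exact ⟨hx.1, hx.2.1, fun l _ hl => hx.2.2 l hl hl⟩

theorem four_le_card_planeGens (hgen : AddSubmonoid.closure (A : Set (Fin d → ℕ)) = S)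
    {F : Fin d → ℕ} (hbox : ∀ h, h ∉ S → h ≤ F) {i : Fin d} (hFi : F i ∉ axisMonoid S i)
    (hi : 1 ∉ axisMonoid S i) {j : Fin d} (hij : i ≠ j) (hj : 1 ∉ axisMonoid S j) :
    4 ≤ (planeGens A i j).card := by
  have hlarge : ∀ x l, F l < x l → x ∈ S := fun x l hl =>
    by_contra fun hx => (hbox x hx l).not_gt hl
  obtain ⟨k, hk, hkA⟩ := exists_single_one_add_single_mem hgen hij hi (n := F j + 1)
    (hlarge _ j (by simp [hij]))
  obtain ⟨m, hm, hmN, hmA⟩ := exists_single_add_single_one_mem hgen hij (n := F i + 1)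
    (hlarge _ i (by simp [hij]))
  have hm0 : m ≠ 0 := by
    rintro rfl
    refine hj (mem_axisMonoid.2 ?_)
    rw [← hgen]
    exact AddSubmonoid.subset_closure (by simpa using hmA)
  have hm1 : m ≠ 1 := by
    rintro rfl
    exact hFi hmN
  have hdisj : Disjoint (planeGens A j j)
      {Pi.single i 1 + Pi.single j k, Pi.single i m + Pi.single j 1} := by
    refine Finset.disjoint_left.2 fun x hx hx' => ?_
    have h0 := (mem_planeGens.1 hx).2.2 i hij hij
    simp only [Finset.mem_insert, Finset.mem_singleton] at hx'
    rcases hx' with rfl | rfl <;> simp [hij] at h0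
    exact hm0 h0
  have hpair : ({Pi.single i 1 + Pi.single j k, Pi.single i m + Pi.single j 1} :
      Finset (Fin d → ℕ)).card = 2 := by
    refine Finset.card_pair fun h => hm1 ?_
    have := congrFun h i
    simp [hij] at this
    exact this.symm
  have hself := two_le_card_planeGens hgen hbox hj j
  calc 4 ≤ (planeGens A j j).card + _ := Nat.add_le_add hself hpair.ge
    _ = _ := (Finset.card_union_of_disjoint hdisj).symm
    _ ≤ _ := Finset.card_le_card ?_
  refine Finset.union_subset (fun x hx => ?_) (fun x hx => ?_)
  · rw [mem_planeGens] at hx ⊢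
    exact ⟨hx.1, hx.2.1, fun l _ hl => hx.2.2 l hl hl⟩
  · simp only [Finset.mem_insert, Finset.mem_singleton] at hx
    rw [mem_planeGens]
    rcases hx with rfl | rfl
    · exact ⟨hkA, by simp [Ne.symm hij, hk], fun l hl hl' => by simp [hl, hl']⟩
    · exact ⟨hmA, by simp [Ne.symm hij], fun l hl hl' => by simp [hl, hl']⟩

theorem one_mem_axisMonoid_of_card_le (hgen : AddSubmonoid.closure (A : Set (Fin d → ℕ)) = S)
    (hcard : A.card ≤ 2 * d + 1) {F : Fin d → ℕ} (hbox : ∀ h, h ∉ S → h ≤ F) {i : Fin d}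
    (hFi : F i ∉ axisMonoid S i) (hi : 1 ∉ axisMonoid S i) {j : Fin d} (hij : i ≠ j) :
    1 ∈ axisMonoid S j := by
  by_contra hj
  have hsum : ∑ l : Fin d, (2 + if l = j then 2 else 0) ≤ ∑ l, (planeGens A i l).card := by
    refine Finset.sum_le_sum fun l _ => ?_
    split_ifs with hl
    · exact hl ▸ four_le_card_planeGens hgen hbox hFi hi hij hj
    · exact two_le_card_planeGens hgen hbox hi l
  have := hsum.trans (sum_card_planeGens_le A i)
  simp [Finset.sum_add_distrib] at this
  omega

theorem card_planeGens_eq_two (hgen : AddSubmonoid.closure (A : Set (Fin d → ℕ)) = S)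
    (hcard : A.card ≤ 2 * d + 1) {F : Fin d → ℕ} (hbox : ∀ h, h ∉ S → h ≤ F) {i : Fin d}
    (hi : 1 ∉ axisMonoid S i) (h3 : 3 ≤ (planeGens A i i).card) {j : Fin d} (hij : i ≠ j) :
    (planeGens A i j).card = 2 := by
  refine le_antisymm ?_ (two_le_card_planeGens hgen hbox hi j)
  by_contra! hj
  have hsum : ∑ l : Fin d, (2 + (if l = i then 1 else 0) + if l = j then 1 else 0) ≤
      ∑ l, (planeGens A i l).card := by
    refine Finset.sum_le_sum fun l _ => ?_
    have := two_le_card_planeGens hgen hbox hi l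
    split_ifs with hl hl' hl'
    · exact absurd (hl.symm.trans hl') hij
    · exact hl ▸ h3
    · exact hl' ▸ hj
    · exact this
  have := hsum.trans (sum_card_planeGens_le A i)
  simp [Finset.sum_add_distrib] at this
  omega

theorem mem_of_le_of_eq {i : Fin d} (hone : ∀ j, i ≠ j → 1 ∈ axisMonoid S j)
    {x y : Fin d → ℕ} (hx : x ∈ S) (hxy : x ≤ y) (hi : x i = y i) : y ∈ S := by
  have hsub : y - x ∈ S := by
    rw [← Finset.univ_sum_single (y - x)]
    refine sum_mem fun l _ => ?_
    by_cases hl : i = l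
    · subst hl
      simp [hi]
    · have := nsmul_mem (hone l hl) ((y - x) l)
      rw [smul_eq_mul, mul_one] at this
      exact this
  simpa [add_tsub_cancel_of_le hxy] using add_mem hx hsub

theorem sub_mem_of_axisMonoid_symmetric {i : Fin d} (hone : ∀ j, i ≠ j → 1 ∈ axisMonoid S j)
    {F : Fin d → ℕ} (hsymm : ∀ u ∉ axisMonoid S i, F i - u ∈ axisMonoid S i)
    {h : Fin d → ℕ} (hh : h ∉ S) : F - h ∈ S := by
  have hhi : h i ∉ axisMonoid S i := fun hN =>
    hh (mem_of_le_of_eq hone hN (single_le_of_le le_rfl) (by simp))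
  exact mem_of_le_of_eq hone (hsymm _ hhi) (single_le_of_le le_rfl) (by simp)

/-- If `e_j` and `e_i + k e_j` are the only generators of the plane off the axis `i`, then below
the multiplicity of the axis `i` the elements of the plane lie on or above the line of slope
`k`. -/
theorem mul_le_of_single_add_single_mem (hgen : AddSubmonoid.closure (A : Set (Fin d → ℕ)) = S)
    {i j : Fin d} (hij : i ≠ j) {k a : ℕ} (ha : ∀ n ∈ axisMonoid S i, n < a → n = 0)
    (hplane : ∀ x ∈ planeGens A i j, x = Pi.single j 1 ∨ x = Pi.single i 1 + Pi.single j k)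
    {u v : ℕ} (hu : u < a) (h : Pi.single i u + Pi.single j v ∈ S) : k * u ≤ v := by
  induction hn : u + v using Nat.strong_induction_on generalizing u v with
  | _ n ih =>
    by_cases h0 : u = 0
    · simp [h0]
    obtain ⟨p, q, hp, hq, hpq, hA, hS⟩ := exists_planar_generator hgen hij h (by omega)
    have hq0 : q ≠ 0 := by
      rintro rfl
      have hpN : p ∈ axisMonoid S i := by
        rw [mem_axisMonoid, ← hgen]
        exact AddSubmonoid.subset_closure (by simpa using hA)
      have := ha p hpN (by omega)
      omega
    have hih := ih _ (by omega) (by omega) hS rfl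
    have hcoord : ∀ p' q' : ℕ, (Pi.single i p + Pi.single j q : Fin d → ℕ) =
        Pi.single i p' + Pi.single j q' → p = p' ∧ q = q' := by
      intro p' q' h
      have hi := congrFun h i
      have hj := congrFun h j
      simp [hij, hij.symm] at hi hj
      exact ⟨hi, hj⟩
    rcases hplane _ (mem_planeGens.2 ⟨hA, by simp [hij.symm, hq0],
      fun l hl hl' => by simp [hl, hl']⟩) with hx | hx
    · obtain ⟨rfl, rfl⟩ := hcoord 0 1 (by simpa using hx)
      simp at hih
      omega
    · obtain ⟨rfl, rfl⟩ := hcoord _ _ hx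
      obtain ⟨w, rfl⟩ := Nat.exists_eq_add_of_le hp
      rw [Nat.add_sub_cancel_left] at hih
      rw [mul_add, mul_one]
      omega

theorem exists_planeGens_eq (hgen : AddSubmonoid.closure (A : Set (Fin d → ℕ)) = S)
    {F : Fin d → ℕ} (hbox : ∀ h, h ∉ S → h ≤ F) {i j : Fin d} (hij : i ≠ j)
    (hi : 1 ∉ axisMonoid S i) (hj : 1 ∈ axisMonoid S j) (h2 : (planeGens A i j).card = 2) :
    ∃ k ≠ 0, Pi.single i 1 + Pi.single j k ∈ S ∧
      ∀ x ∈ planeGens A i j, x = Pi.single j 1 ∨ x = Pi.single i 1 + Pi.single j k := by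
  obtain ⟨k, hk, -, hjA⟩ := exists_single_add_single_one_mem hgen hij (n := 0)
    (by simpa using mem_axisMonoid.1 hj)
  obtain rfl : k = 0 := by omega
  obtain ⟨k, hk, hkA⟩ := exists_single_one_add_single_mem hgen hij hi (n := F j + 1)
    (by_contra fun hx => (hbox _ hx j).not_gt (by simp [hij]))
  refine ⟨k, hk, hgen ▸ AddSubmonoid.subset_closure hkA, ?_⟩
  rw [Pi.single_zero, zero_add] at hjA
  have hne : (Pi.single j 1 : Fin d → ℕ) ≠ Pi.single i 1 + Pi.single j k := fun h => by
    simpa [hij] using congrFun h i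
  have hsub : {Pi.single j 1, Pi.single i 1 + Pi.single j k} ⊆ planeGens A i j := by
    intro x hx
    simp only [Finset.mem_insert, Finset.mem_singleton] at hx
    rw [mem_planeGens]
    rcases hx with rfl | rfl
    · exact ⟨hjA, by simp, fun l _ hl => by simp [hl]⟩
    · exact ⟨hkA, by simp [hij.symm, hk], fun l hl hl' => by simp [hl, hl']⟩
  have heq := Finset.eq_of_subset_of_card_le hsub (by rw [h2, Finset.card_pair hne])
  intro x hx
  rw [← heq] at hx
  simpa using hx

theorem mem_of_mul_mod_le {i j : Fin d} (hij : i ≠ j)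
    (hone : ∀ l, i ≠ l → 1 ∈ axisMonoid S l) {k a : ℕ} (ha : a ∈ axisMonoid S i)
    (hk : Pi.single i 1 + Pi.single j k ∈ S) {x : Fin d → ℕ} (hx : k * (x i % a) ≤ x j) :
    x ∈ S := by
  have hmul : Pi.single i (x i / a * a) ∈ S := by
    have := nsmul_mem ha (x i / a)
    rwa [smul_eq_mul] at this
  have hdm := Nat.div_add_mod' (x i) a
  refine mem_of_le_of_eq hone (add_mem hmul (nsmul_mem hk (x i % a))) (fun l => ?_) ?_
  · by_cases hi : l = i
    · subst hi; simp [hij, hdm]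
    · by_cases hj : l = j
      · subst hj; simp [hi]; linarith
      · simp [hi, hj]
  · simp [hij, hdm]

theorem sub_mem_of_unique_maximal_gap (hd : 2 ≤ d)
    (hgen : AddSubmonoid.closure (A : Set (Fin d → ℕ)) = S) (hcard : A.card ≤ 2 * d + 1)
    {F : Fin d → ℕ} (hF : F ∉ S) (hbox : ∀ h, h ∉ S → h ≤ F) {h : Fin d → ℕ} (hh : h ∉ S) :
    F - h ∈ S := by
  obtain ⟨i, hFi⟩ : ∃ i, F i ∉ axisMonoid S i := by
    by_contra! hall
    refine hF ?_
    rw [← Finset.univ_sum_single F]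
    exact sum_mem fun l _ => hall l
  have hi : 1 ∉ axisMonoid S i := fun h1 => hFi (by simpa using nsmul_mem h1 (F i))
  have hone : ∀ j, i ≠ j → 1 ∈ axisMonoid S j := fun j hij =>
    one_mem_axisMonoid_of_card_le hgen hcard hbox hFi hi hij
  have hgt : ∀ n, F i < n → n ∈ axisMonoid S i := fun n hn =>
    by_contra fun hx => (hbox _ hx i).not_gt (by simpa using hn)
  by_cases h3 : (planeGens A i i).card < 3
  · obtain ⟨x, y, -, hxy⟩ := Finset.card_eq_two.1
      (le_antisymm (Nat.le_of_lt_succ h3) (two_le_card_planeGens hgen hbox hi i))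
    have hN : axisMonoid S i = AddSubmonoid.closure {x i, y i} := by
      rw [axisMonoid_eq_closure hgen, hxy]
      simp [Finset.image_insert]
    refine sub_mem_of_axisMonoid_symmetric hone (fun u hu => ?_) hh
    rw [hN] at hFi hgt hu ⊢
    exact sub_mem_closure_pair hFi hgt hu
  classical
  have hex : ∃ n, n ≠ 0 ∧ n ∈ axisMonoid S i := ⟨F i + 1, by omega, hgt _ (by omega)⟩
  obtain ⟨a, ha0, haN, hamin⟩ : ∃ a, a ≠ 0 ∧ a ∈ axisMonoid S i ∧
      ∀ n ∈ axisMonoid S i, n < a → n = 0 :=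
    ⟨Nat.find hex, (Nat.find_spec hex).1, (Nat.find_spec hex).2, fun n hn hlt =>
      by_contra fun h0 => Nat.find_min hex hlt ⟨h0, hn⟩⟩
  have ha2 : 2 ≤ a := by
    have : a ≠ 1 := by rintro rfl; exact hi haN
    omega
  have : Nontrivial (Fin d) := Fin.nontrivial_iff_two_le.2 hd
  obtain ⟨j, hji⟩ := exists_ne i
  obtain ⟨k, hk, hkS, hplane⟩ := exists_planeGens_eq hgen hbox hji.symm hi (hone j hji.symm)
    (card_planeGens_eq_two hgen hcard hbox hi (not_lt.1 h3) hji.symm)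
  have hkF : k * (a - 1) ≤ F j + 1 := by
    have hpos : 0 < k * (a - 1) := Nat.mul_pos (by omega) (by omega)
    have hgap : (Pi.single i (a - 1) + Pi.single j (k * (a - 1) - 1) : Fin d → ℕ) ∉ S := by
      intro hS
      have := mul_le_of_single_add_single_mem hgen hji.symm hamin hplane (by omega) hS
      omega
    have := hbox _ hgap j
    simp [hji] at this
    omega
  have hmod : F i % a < a := Nat.mod_lt _ (by omega)
  have hdm := Nat.div_add_mod' (F i) a
  have hFj : F j < k * (F i % a) := by
    by_contra! hle
    exact hF (mem_of_mul_mod_le hji.symm hone haN hkS hle)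
  have hma : F i % a = a - 1 := by
    have : a - 1 ≤ F i % a := Nat.le_of_mul_le_mul_left (hkF.trans hFj) (by omega)
    omega
  rw [hma] at hFj
  have hhF := hbox h hh
  have hhj : h j < k * (h i % a) := by
    by_contra! hle
    exact hh (mem_of_mul_mod_le hji.symm hone haN hkS hle)
  refine mem_of_mul_mod_le hji.symm hone haN hkS ?_
  have hhmod : h i % a ≤ a - 1 := Nat.le_sub_one_of_lt (Nat.mod_lt _ (by omega))
  have hsub : (F i - h i) % a = a - 1 - h i % a := by
    obtain ⟨q, hq⟩ := Nat.exists_eq_add_of_le (Nat.div_le_div_right (c := a) (hhF i))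
    have hdh := Nat.div_add_mod' (h i) a
    have : F i - h i = a - 1 - h i % a + q * a := by
      rw [hq, add_mul] at hdm
      omega
    rw [this, Nat.add_mul_mod_self_right, Nat.mod_eq_of_lt (by omega)]
  rw [Pi.sub_apply, Pi.sub_apply, hsub, Nat.mul_sub]
  have := Nat.mul_le_mul_left k hhmod
  omega

end plane

theorem PF_eq_singleton {d : ℕ} {S : AddSubmonoid (Fin d → ℕ)} {F : Fin d → ℕ} (hF : F ∉ S)
    (hbox : ∀ h, h ∉ S → h ≤ F) (hsub : ∀ h, h ∉ S → F - h ∈ S) : PF S = {F} := by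
  ext h
  constructor
  · rintro ⟨hh, hPF⟩
    by_contra hne
    have hadd := add_tsub_cancel_of_le (hbox h hh)
    refine hF (hadd ▸ hPF _ (hsub h hh) fun h0 => hne ?_)
    rw [h0, add_zero] at hadd
    exact hadd
  · rintro rfl
    refine ⟨hF, fun s hs hs0 => by_contra fun hgap => hs0 ?_⟩
    simpa using hbox _ hgap

theorem FA_subset_PF {d : ℕ} (S : AddSubmonoid (Fin d → ℕ)) : FA S ⊆ PF S := fun _ hh =>
  ⟨hh.1, fun s _ hs0 => by_contra fun hgap => hs0 (by simpa using hh.2 _ hgap le_self_add)⟩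

theorem exists_mem_FA_ge {d : ℕ} {S : AddSubmonoid (Fin d → ℕ)}
    (hfin : {x : Fin d → ℕ | x ∉ S}.Finite) {h : Fin d → ℕ} (hh : h ∉ S) : ∃ F ∈ FA S, h ≤ F := by
  obtain ⟨F, hhF, hF⟩ := hfin.exists_le_maximal hh
  exact ⟨F, ⟨hF.prop, fun g hg hle => (hF.eq_of_le hg hle).symm⟩, hhF⟩

/-- for d ≥ 2 and embedding dimension 2d+1,
S is symmetric iff it has a unique maximal gap. -/
theorem symmetric_iff_unique_FA_edim_2d_plus_1
    (d : ℕ) (hd : 2 ≤ d)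
    (S : AddSubmonoid (Fin d → ℕ))
    (hfin : {x : Fin d → ℕ | x ∉ S}.Finite)
    (A : Finset (Fin d → ℕ))
    (hgen : AddSubmonoid.closure (A : Set (Fin d → ℕ)) = S)
    (hmin : ∀ B ⊂ A, AddSubmonoid.closure (B : Set (Fin d → ℕ)) ≠ S)
    (hcard : A.card = 2 * d + 1) :
    (PF S).ncard = 1 ↔ (FA S).ncard = 1 := by
  constructor
  · intro h
    obtain ⟨F, hF⟩ := Set.ncard_eq_one.1 h
    have hFgap : F ∉ S := (hF.ge rfl : F ∈ PF S).1
    obtain ⟨G, hG, -⟩ := exists_mem_FA_ge hfin hFgap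
    refine Set.ncard_eq_one.2 ⟨F, (Set.Nonempty.subset_singleton_iff ⟨G, hG⟩).1 ?_⟩
    exact (FA_subset_PF S).trans hF.le
  · intro h
    obtain ⟨F, hF⟩ := Set.ncard_eq_one.1 h
    have hFgap : F ∉ S := (hF.ge rfl : F ∈ FA S).1
    have hbox : ∀ h, h ∉ S → h ≤ F := by
      intro h hh
      obtain ⟨G, hG, hle⟩ := exists_mem_FA_ge hfin hh
      exact (show G = F from hF.le hG) ▸ hle
    exact Set.ncard_eq_one.2 ⟨F, PF_eq_singleton hFgap hbox fun h hh =>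
      sub_mem_of_unique_maximal_gap hd hgen hcard.le hFgap hbox hh⟩
end

section
/- Every almost symmetric generalized numerical semigroup in ℕ^d (d ≥ 2) of embedding dimension 2d+1 has type at most 2; in fact its type equals 1. -/
/-- S is almost symmetric. -/
def AlmostSymmetric {d : ℕ} (S : AddSubmonoid (Fin d → ℕ)) : Prop :=
  ∃ f, FA S = {f} ∧ ∀ p ∈ PF S, p ≠ f → f - p ∈ PF S

section Generators

variable {d : ℕ} {A : Set (Fin d → ℕ)}

lemma eq_single_of_forall_ne {x : Fin d → ℕ} {j : Fin d} (h : ∀ l, l ≠ j → x l = 0) :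
    x = Pi.single j (x j) := by
  ext l
  by_cases hl : l = j
  · subst hl; simp
  · simp [hl, h l hl]

lemma exists_generator_of_apply_eq_one {x : Fin d → ℕ} {j : Fin d}
    (hx : x ∈ AddSubmonoid.closure A) (hj : x j = 1) :
    ∃ a ∈ A, a j = 1 ∧ ∃ y ∈ AddSubmonoid.closure A, x = a + y := by
  induction hx using AddSubmonoid.closure_induction with
  | mem x hx => exact ⟨x, hx, hj, 0, zero_mem _, by simp⟩
  | zero => simp at hj
  | add x y hx hy ihx ihy =>
    have h : x j = 1 ∨ y j = 1 := by
      simp only [Pi.add_apply] at hj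
      omega
    rcases h with h | h
    · obtain ⟨a, ha, haj, z, hz, rfl⟩ := ihx h
      exact ⟨a, ha, haj, z + y, add_mem hz hy, by rw [add_assoc]⟩
    · obtain ⟨a, ha, haj, z, hz, rfl⟩ := ihy h
      exact ⟨a, ha, haj, x + z, add_mem hx hz, by rw [add_left_comm]⟩

lemma single_one_mem_generators {j : Fin d}
    (h : (Pi.single j 1 : Fin d → ℕ) ∈ AddSubmonoid.closure A) :
    (Pi.single j 1 : Fin d → ℕ) ∈ A := by
  obtain ⟨a, ha, haj, y, -, hy⟩ := exists_generator_of_apply_eq_one h (j := j) (by simp)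
  convert ha using 1
  rw [eq_single_of_forall_ne (x := a) (j := j), haj]
  intro l hl
  have := congrFun hy l
  simp [hl] at this
  omega

lemma apply_mem_closure_of_axis {x : Fin d → ℕ} {j : Fin d}
    (hx : x ∈ AddSubmonoid.closure A) (h : ∀ l, l ≠ j → x l = 0) :
    x j ∈ AddSubmonoid.closure {m : ℕ | (Pi.single j m : Fin d → ℕ) ∈ A} := by
  induction hx using AddSubmonoid.closure_induction with
  | mem x hx =>
    apply AddSubmonoid.subset_closure
    rw [Set.mem_ofPred_eq, ← eq_single_of_forall_ne h]
    exact hx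
  | zero => exact zero_mem _
  | add x y hx hy ihx ihy =>
    have h' : ∀ l, l ≠ j → x l = 0 ∧ y l = 0 := fun l hl => by
      have := h l hl
      simp only [Pi.add_apply] at this
      omega
    exact add_mem (ihx fun l hl => (h' l hl).1) (ihy fun l hl => (h' l hl).2)

lemma mem_closure_of_single_mem {j : Fin d} {n : ℕ}
    (h : (Pi.single j n : Fin d → ℕ) ∈ AddSubmonoid.closure A) :
    n ∈ AddSubmonoid.closure {m : ℕ | (Pi.single j m : Fin d → ℕ) ∈ A} := by
  have := apply_mem_closure_of_axis h (j := j) (fun l hl => by simp [hl])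
  simpa using this

lemma exists_add_single_mem {S : AddSubmonoid (Fin d → ℕ)}
    (hfin : {x : Fin d → ℕ | x ∉ S}.Finite) (b : Fin d → ℕ) (i : Fin d) :
    ∃ N, ∀ n ≥ N, b + Pi.single i n ∈ S := by
  have hinj : Function.Injective fun n : ℕ => b + (Pi.single i n : Fin d → ℕ) := by
    intro m n h
    have := congrFun h i
    simpa using this
  obtain ⟨N, hN⟩ := (hfin.preimage hinj.injOn).bddAbove
  refine ⟨N + 1, fun n hn => ?_⟩
  by_contra h
  have := hN (show n ∈ _ from h)
  omega

variable {S : AddSubmonoid (Fin d → ℕ)}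

lemma exists_axis_generator (hfin : {x : Fin d → ℕ | x ∉ S}.Finite)
    (hgen : AddSubmonoid.closure A = S) (i : Fin d) :
    ∃ u, u ≠ 0 ∧ (Pi.single i u : Fin d → ℕ) ∈ A := by
  by_contra! h
  obtain ⟨N, hN⟩ := exists_add_single_mem hfin 0 i
  have h1 := hN (N + 1) (by omega)
  rw [zero_add, ← hgen] at h1
  have h2 := mem_closure_of_single_mem h1
  have h3 : AddSubmonoid.closure {m : ℕ | (Pi.single i m : Fin d → ℕ) ∈ A} ≤ ⊥ := by
    rw [AddSubmonoid.closure_le]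
    intro m hm
    by_contra h0
    exact h m h0 hm
  have := h3 h2
  simp at this

lemma exists_two_axis_generators (hfin : {x : Fin d → ℕ | x ∉ S}.Finite)
    (hgen : AddSubmonoid.closure A = S) {j : Fin d}
    (hj : (Pi.single j 1 : Fin d → ℕ) ∉ S) :
    ∃ u v, u ≠ 0 ∧ v ≠ 0 ∧ u ≠ v ∧ (Pi.single j u : Fin d → ℕ) ∈ A ∧
      (Pi.single j v : Fin d → ℕ) ∈ A := by
  obtain ⟨u, hu0, hu⟩ := exists_axis_generator hfin hgen j
  by_contra! h
  obtain ⟨N, hN⟩ := exists_add_single_mem hfin 0 j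
  have h3 : AddSubmonoid.closure {m : ℕ | (Pi.single j m : Fin d → ℕ) ∈ A} ≤
      AddSubmonoid.multiples u := by
    rw [AddSubmonoid.closure_le]
    intro m hm
    by_cases h0 : m = 0
    · subst h0; exact zero_mem _
    · by_cases huv : u = m
      · subst huv; exact AddSubmonoid.mem_multiples u
      · exact absurd hm (h u m hu0 h0 huv hu)
  have hdvd : ∀ n ≥ N, u ∣ n := by
    intro n hn
    have h1 := hN n hn
    rw [zero_add, ← hgen] at h1
    obtain ⟨k, hk⟩ := (AddSubmonoid.mem_multiples_iff _ _).1 (h3 (mem_closure_of_single_mem h1))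
    exact ⟨k, by rw [← hk, smul_eq_mul, mul_comm]⟩
  have hu1 : u = 1 := Nat.dvd_one.1
    ((Nat.dvd_add_right (hdvd N le_rfl)).1 (hdvd (N + 1) (by omega)))
  subst hu1
  exact hj (hgen ▸ AddSubmonoid.subset_closure hu)

lemma exists_mixed_generator (hfin : {x : Fin d → ℕ | x ∉ S}.Finite)
    (hgen : AddSubmonoid.closure A = S) {i j : Fin d} (hij : i ≠ j)
    (hj : (Pi.single j 1 : Fin d → ℕ) ∉ S) :
    ∃ m, m ≠ 0 ∧ (Pi.single j 1 + Pi.single i m : Fin d → ℕ) ∈ A := by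
  obtain ⟨N, hN⟩ := exists_add_single_mem hfin (Pi.single j 1) i
  have h1 := hN N le_rfl
  rw [← hgen] at h1
  obtain ⟨a, ha, haj, y, -, hy⟩ :=
    exists_generator_of_apply_eq_one h1 (j := j) (by simp [hij.symm])
  have hax : a = Pi.single j 1 + Pi.single i (a i) := by
    ext l
    have hl := congrFun hy l
    by_cases hlj : l = j
    · subst hlj; simp [haj, hij.symm]
    · by_cases hli : l = i
      · subst hli; simp [hij]
      · simp [hlj, hli] at hl ⊢
        omega
  refine ⟨a i, fun h0 => hj ?_, hax ▸ ha⟩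
  rw [h0, Pi.single_zero, add_zero] at hax
  rw [← hax, ← hgen]
  exact AddSubmonoid.subset_closure ha

end Generators

section Symmetry

/-- A numerical semigroup generated by two elements is symmetric. -/
lemma mem_or_mem_of_add_eq_max_gap {a b f : ℕ}
    (hf : f ∉ AddSubmonoid.closure ({a, b} : Set ℕ))
    (hmax : ∀ n, f < n → n ∈ AddSubmonoid.closure ({a, b} : Set ℕ)) {p q : ℕ}
    (hpq : p + q = f) :
    p ∈ AddSubmonoid.closure ({a, b} : Set ℕ) ∨ q ∈ AddSubmonoid.closure ({a, b} : Set ℕ) := by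
  have key : ∀ n, n ∈ AddSubmonoid.closure ({a, b} : Set ℕ) ↔ ∃ x y : ℕ, x * a + y * b = n := by
    intro n
    simp [AddSubmonoid.mem_closure_pair]
  have hco : Nat.Coprime a b := by
    have hdvd : ∀ n, f < n → Nat.gcd a b ∣ n := by
      intro n hn
      obtain ⟨x, y, rfl⟩ := (key n).1 (hmax n hn)
      exact dvd_add (dvd_mul_of_dvd_right (Nat.gcd_dvd_left a b) _)
        (dvd_mul_of_dvd_right (Nat.gcd_dvd_right a b) _)
    exact Nat.dvd_one.1 ((Nat.dvd_add_right (hdvd (f + 1) (by omega))).1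
      (hdvd (f + 1 + 1) (by omega)))
  have ha1 : a ≠ 1 := by
    rintro rfl
    exact hf ((key f).2 ⟨f, 0, by simp⟩)
  have hb1 : b ≠ 1 := by
    rintro rfl
    exact hf ((key f).2 ⟨0, f, by simp⟩)
  have ha0 : a ≠ 0 := by
    rintro rfl
    simp at hco
    exact hb1 hco
  have hb0 : b ≠ 0 := by
    rintro rfl
    simp at hco
    exact ha1 hco
  have hF : f = a * b - a - b := by
    have h1 := frobeniusNumber_pair hco (by omega) (by omega)
    have h2 : FrobeniusNumber f {a, b} := by
      refine ⟨hf, fun n hn => ?_⟩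
      by_contra h
      exact hn (hmax n (by omega))
    exact h2.unique h1
  have hab : a + b ≤ a * b := Nat.add_le_mul (by omega) (by omega)
  have hF' : (p : ℤ) + q = a * b - a - b := by
    have : p + q + a + b = a * b := by omega
    have : (p : ℤ) + q + a + b = a * b := by exact_mod_cast this
    linarith
  obtain ⟨x, y, hx0, hxb, hxy⟩ : ∃ x y : ℤ, 0 ≤ x ∧ x < b ∧ x * a + y * b = p := by
    have hbez := Nat.gcd_eq_gcd_ab a b
    rw [hco] at hbez
    push_cast at hbez
    refine ⟨(p * Nat.gcdA a b) % b, p * Nat.gcdB a b + ((p * Nat.gcdA a b) / b) * a,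
      Int.emod_nonneg _ (by omega), Int.emod_lt_of_pos _ (by omega), ?_⟩
    have := Int.emod_add_mul_ediv (p * Nat.gcdA a b) b
    linear_combination (-(p : ℤ)) * hbez + (a : ℤ) * this
  by_cases hy : 0 ≤ y
  · left
    refine (key p).2 ⟨x.toNat, y.toNat, ?_⟩
    zify
    rw [Int.toNat_of_nonneg hx0, Int.toNat_of_nonneg hy, hxy]
  · right
    refine (key q).2 ⟨(b - 1 - x).toNat, (-1 - y).toNat, ?_⟩
    zify
    rw [Int.toNat_of_nonneg (by omega), Int.toNat_of_nonneg (by omega)]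
    linear_combination (-1 : ℤ) * hxy - hF'

end Symmetry

section MaximalGap

variable {d : ℕ} {S : AddSubmonoid (Fin d → ℕ)} {f : Fin d → ℕ}

lemma gap_le_of_FA_eq_singleton (hfin : {x : Fin d → ℕ | x ∉ S}.Finite) (hFA : FA S = {f})
    {x : Fin d → ℕ} (hx : x ∉ S) : x ≤ f := by
  obtain ⟨m, hxm, hm⟩ := hfin.exists_le_maximal (a := x) hx
  have : m ∈ FA S := ⟨hm.prop, fun g hg hmg => le_antisymm (hm.le_of_ge hg hmg) hmg⟩
  rw [hFA] at this
  rwa [← Set.mem_singleton_iff.1 this]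

lemma mem_PF_of_mem_FA (hf : f ∈ FA S) : f ∈ PF S := by
  refine ⟨hf.1, fun s _ hs0 => ?_⟩
  by_contra h
  exact hs0 (add_eq_left.1 (hf.2 _ h le_self_add))

lemma mem_of_forall_single_mem {x : Fin d → ℕ} (h : ∀ i, (Pi.single i (x i) : Fin d → ℕ) ∈ S) :
    x ∈ S := by
  rw [← Finset.univ_sum_single x]
  exact sum_mem fun i _ => h i

lemma single_mem_of_single_one_mem {i : Fin d} (h : (Pi.single i 1 : Fin d → ℕ) ∈ S) (n : ℕ) :
    (Pi.single i n : Fin d → ℕ) ∈ S := by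
  have := nsmul_mem h n
  rwa [← Pi.single_smul, smul_eq_mul, mul_one] at this

lemma mem_of_single_apply_mem {j : Fin d} (he : ∀ i, i ≠ j → (Pi.single i 1 : Fin d → ℕ) ∈ S)
    {x : Fin d → ℕ} (hx : (Pi.single j (x j) : Fin d → ℕ) ∈ S) : x ∈ S := by
  refine mem_of_forall_single_mem fun i => ?_
  by_cases hi : i = j
  · exact hi ▸ hx
  · exact single_mem_of_single_one_mem (he i hi) _

/-- When `e_i ∈ S` for `i ≠ j` and the `j`-th axis has only two generators, `S` has no
pseudo-Frobenius elements adding up to the maximal gap. -/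
lemma false_of_two_axis_generators {A : Set (Fin d → ℕ)} {j : Fin d} {u v : ℕ}
    (hgen : AddSubmonoid.closure A = S)
    (he : ∀ i, i ≠ j → (Pi.single i 1 : Fin d → ℕ) ∈ S)
    (haxis : {m : ℕ | (Pi.single j m : Fin d → ℕ) ∈ A} = {u, v})
    (hle : ∀ x, x ∉ S → x ≤ f) (hf : f ∉ S) {p q : Fin d → ℕ} (hp : p ∉ S) (hq : q ∉ S)
    (hpq : p + q = f) : False := by
  have hmem : ∀ n, (Pi.single j n : Fin d → ℕ) ∈ S ↔
      n ∈ AddSubmonoid.closure ({u, v} : Set ℕ) := by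
    intro n
    rw [← haxis]
    refine ⟨fun h => mem_closure_of_single_mem (hgen ▸ h), fun h => ?_⟩
    induction h using AddSubmonoid.closure_induction with
    | mem x hx => exact hgen ▸ AddSubmonoid.subset_closure hx
    | zero => rw [Pi.single_zero]; exact zero_mem _
    | add x y _ _ ihx ihy => rw [Pi.single_add]; exact add_mem ihx ihy
  have h := mem_or_mem_of_add_eq_max_gap (a := u) (b := v) (f := f j) (p := p j) (q := q j)
    (fun h => hf (mem_of_single_apply_mem he ((hmem _).2 h)))
    (fun n hn => by
      rw [← hmem]
      by_contra h
      have := hle _ h j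
      simp at this
      omega)
    (by rw [← hpq]; rfl)
  rcases h with h | h
  · exact hp (mem_of_single_apply_mem he ((hmem _).2 h))
  · exact hq (mem_of_single_apply_mem he ((hmem _).2 h))

end MaximalGap

section Staircase

variable {d : ℕ} {S : AddSubmonoid (Fin d → ℕ)} {A : Set (Fin d → ℕ)} {j : Fin d} {m : Fin d → ℕ}

/-- The number of generators `e_j + m_i e_i` that fit below `x` away from the `j`-th axis. -/
def level (j : Fin d) (m x : Fin d → ℕ) : ℕ :=
  ∑ i ∈ Finset.univ.erase j, x i / m i

lemma level_add_le (x y : Fin d → ℕ) : level j m x + level j m y ≤ level j m (x + y) := by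
  rw [level, level, level, ← Finset.sum_add_distrib]
  exact Finset.sum_le_sum fun i _ => Nat.div_add_div_le_add_div

lemma level_add_single {i : Fin d} (hi : i ≠ j) (x : Fin d → ℕ) (n : ℕ) :
    level j m (x + Pi.single i n) + x i / m i = level j m x + (x i + n) / m i := by
  have hmem : i ∈ Finset.univ.erase j := by simp [hi]
  rw [level, level, ← Finset.add_sum_erase _ _ hmem, ← Finset.add_sum_erase _ _ hmem]
  have : ∑ l ∈ (Finset.univ.erase j).erase i, (x + Pi.single i n : Fin d → ℕ) l / m l =
      ∑ l ∈ (Finset.univ.erase j).erase i, x l / m l := by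
    refine Finset.sum_congr rfl fun l hl => ?_
    simp [Finset.ne_of_mem_erase hl]
  rw [this]
  simp
  ring

lemma level_add_single_self (x : Fin d → ℕ) (n : ℕ) :
    level j m (x + Pi.single j n) = level j m x := by
  refine Finset.sum_congr rfl fun l hl => ?_
  simp [Finset.ne_of_mem_erase hl]

lemma mem_iff_level (hgen : AddSubmonoid.closure A = S)
    (he : ∀ i, i ≠ j → (Pi.single i 1 : Fin d → ℕ) ∈ S)
    (hm : ∀ i, i ≠ j → m i ≠ 0)
    (hmix : ∀ i, i ≠ j → (Pi.single j 1 + Pi.single i (m i) : Fin d → ℕ) ∈ S)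
    (hA : ∀ a ∈ A, (∃ n, a = Pi.single j n) ∨
      ∃ i, i ≠ j ∧ (a = Pi.single i 1 ∨ a = Pi.single j 1 + Pi.single i (m i)))
    (x : Fin d → ℕ) :
    x ∈ S ↔ ∃ s, (Pi.single j s : Fin d → ℕ) ∈ S ∧ s ≤ x j ∧ x j ≤ s + level j m x := by
  constructor
  · intro hx
    rw [← hgen] at hx
    induction hx using AddSubmonoid.closure_induction with
    | mem a ha =>
      rcases hA a ha with ⟨n, rfl⟩ | ⟨i, hi, rfl | rfl⟩
      · exact ⟨n, hgen ▸ AddSubmonoid.subset_closure ha, by simp, by simp⟩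
      · exact ⟨0, by rw [Pi.single_zero]; exact zero_mem _, by simp, by simp [hi.symm]⟩
      · refine ⟨0, by rw [Pi.single_zero]; exact zero_mem _, by simp, ?_⟩
        have h := level_add_single (m := m) hi (Pi.single j 1) (m i)
        simp [hi, Nat.div_self (Nat.pos_of_ne_zero (hm i hi))] at h
        simp [hi.symm]
        omega
    | zero => exact ⟨0, by rw [Pi.single_zero]; exact zero_mem _, by simp, by simp⟩
    | add x y _ _ ihx ihy =>
      obtain ⟨s, hs, hs1, hs2⟩ := ihx
      obtain ⟨t, ht, ht1, ht2⟩ := ihy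
      have := level_add_le (j := j) (m := m) x y
      refine ⟨s + t, by rw [Pi.single_add]; exact add_mem hs ht, ?_, ?_⟩ <;>
        simp only [Pi.add_apply] <;> omega
  · rintro ⟨s, hs, hs1, hs2⟩
    obtain ⟨n, hn⟩ := Nat.exists_eq_add_of_le hs1
    induction n generalizing x with
    | zero =>
      refine mem_of_single_apply_mem he ?_
      rw [hn]; exact hs
    | succ n ih =>
      obtain ⟨i, hi, hi0⟩ : ∃ i ∈ Finset.univ.erase j, x i / m i ≠ 0 :=
        Finset.exists_ne_zero_of_sum_ne_zero (s := Finset.univ.erase j)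
          (f := fun i => x i / m i) (by change level j m x ≠ 0; omega)
      have hij : i ≠ j := Finset.ne_of_mem_erase hi
      have hmi : m i ≤ x i := by
        by_contra h
        exact hi0 (Nat.div_eq_of_lt (by omega))
      obtain ⟨y, rfl⟩ : ∃ y, x = y + (Pi.single j 1 + Pi.single i (m i)) := by
        refine ⟨x - (Pi.single j 1 + Pi.single i (m i)), (tsub_add_cancel_of_le ?_).symm⟩
        intro l
        by_cases hlj : l = j
        · subst hlj; simp [hij.symm]; omega
        · by_cases hli : l = i
          · subst hli; simp [hlj]; omega
          · simp [hlj, hli]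
      refine add_mem (ih y ?_ ?_ ?_) (hmix i hij)
      · simp [hij.symm] at hn; omega
      · have h1 := level_add_single (m := m) hij (y + Pi.single j 1) (m i)
        rw [level_add_single_self, add_assoc] at h1
        simp only [Pi.add_apply, Pi.single_eq_of_ne hij, add_zero,
          Nat.add_div_right _ (Nat.pos_of_ne_zero (hm i hij))] at h1
        simp [hij.symm] at hn hs2
        omega
      · simp [hij.symm] at hn; omega

/-- The height over its level of an element `p ∉ S` with `p + e_i ∈ S`. -/
lemma apply_eq_of_add_single_mem
    (hS : ∀ x, x ∈ S ↔
      ∃ s, (Pi.single j s : Fin d → ℕ) ∈ S ∧ s ≤ x j ∧ x j ≤ s + level j m x)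
    {i : Fin d} (hi : i ≠ j) {p : Fin d → ℕ} (hp : p ∉ S) (hpi : p + Pi.single i 1 ∈ S) :
    m i ∣ p i + 1 ∧ ∃ s, (Pi.single j s : Fin d → ℕ) ∈ S ∧ p j = s + level j m p + 1 := by
  obtain ⟨s, hs, hs1, hs2⟩ := (hS _).1 hpi
  simp [hi.symm] at hs1 hs2
  have h1 : s + level j m p < p j := by
    by_contra h
    exact hp ((hS p).2 ⟨s, hs, hs1, by omega⟩)
  have h2 := level_add_single (m := m) hi p 1
  rw [Nat.succ_div] at h2
  split_ifs at h2 with h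
  · exact ⟨h, s, hs, by omega⟩
  · omega

lemma false_of_staircase
    (hS : ∀ x, x ∈ S ↔
      ∃ s, (Pi.single j s : Fin d → ℕ) ∈ S ∧ s ≤ x j ∧ x j ≤ s + level j m x)
    (he : ∀ i, i ≠ j → (Pi.single i 1 : Fin d → ℕ) ∈ S)
    (hj : (Pi.single j 1 : Fin d → ℕ) ∉ S)
    (hpos : ∃ a, a ≠ 0 ∧ (Pi.single j a : Fin d → ℕ) ∈ S)
    {i₀ : Fin d} (hi₀ : i₀ ≠ j) {f : Fin d → ℕ}
    (hle : ∀ x, x ∉ S → x ≤ f) {p q : Fin d → ℕ}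
    (hf : f ∈ PF S) (hp : p ∈ PF S) (hq : q ∈ PF S) (hpq : p + q = f) : False := by
  have hstep : ∀ r ∈ PF S, ∀ i, i ≠ j → m i ∣ r i + 1 ∧
      ∃ s, (Pi.single j s : Fin d → ℕ) ∈ S ∧ r j = s + level j m r + 1 := fun r hr i hi =>
    apply_eq_of_add_single_mem hS hi hr.1 (hr.2 _ (he i hi) (by simp))
  have hm1 : ∀ i, i ≠ j → m i = 1 := by
    intro i hi
    have h1 := (hstep p hp i hi).1
    have h2 := (hstep q hq i hi).1
    have h3 := (hstep f hf i hi).1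
    have h4 := dvd_add h1 h2
    have h5 : p i + 1 + (q i + 1) = f i + 1 + 1 := by
      rw [← hpq, Pi.add_apply]; omega
    rw [h5] at h4
    exact Nat.dvd_one.1 ((Nat.dvd_add_right h3).1 h4)
  have hlevel : ∀ x, level j m x = ∑ i ∈ Finset.univ.erase j, x i := fun x =>
    Finset.sum_congr rfl fun i hi => by rw [hm1 i (Finset.ne_of_mem_erase hi), Nat.div_one]
  have hadd : level j m f = level j m p + level j m q := by
    rw [hlevel, hlevel, hlevel, ← Finset.sum_add_distrib, ← hpq]
    rfl
  obtain ⟨-, s, hs, hsp⟩ := hstep p hp i₀ hi₀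
  obtain ⟨-, t, ht, htq⟩ := hstep q hq i₀ hi₀
  obtain ⟨-, w, hw, hwf⟩ := hstep f hf i₀ hi₀
  classical
  obtain ⟨ha0, ha⟩ := Nat.find_spec hpos
  have hmin := fun b => Nat.find_min hpos (m := b)
  set a := Nat.find hpos
  have ha1 : a ≠ 1 := fun h => hj (h ▸ ha)
  have hlow : a - 2 ≤ level j m f := by
    have hgap : (Pi.single j (a - 1) + Pi.single i₀ (a - 2) : Fin d → ℕ) ∉ S := by
      intro h
      obtain ⟨b, hb, hb1, hb2⟩ := (hS _).1 h
      have h1 := level_add_single (m := m) hi₀ (Pi.single j (a - 1)) (a - 2)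
      have h2 : level j m (Pi.single j (a - 1)) = 0 := by
        have h3 := level_add_single_self (j := j) (m := m) 0 (a - 1)
        rw [zero_add] at h3
        rw [h3]
        simp [level]
      simp [hm1 i₀ hi₀, hi₀, h2] at h1
      simp [hi₀.symm] at hb1 hb2
      by_cases hb0 : b = 0
      · omega
      · exact hmin b (by omega) ⟨hb0, hb⟩
    have h1 := hle _ hgap i₀
    simp [hi₀] at h1
    have h2 : f i₀ ≤ level j m f := by
      rw [hlevel]
      exact Finset.single_le_sum (f := f) (fun _ _ => Nat.zero_le _) (by simp [hi₀])
    omega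
  have hhigh : f j < w + a := by
    by_contra h
    refine hf.1 ((hS f).2 ⟨w + a, by rw [Pi.single_add]; exact add_mem hw ha, ?_, ?_⟩) <;> omega
  have hfj : f j = s + t + a := by
    have : f j = p j + q j := by rw [← hpq]; rfl
    omega
  refine hf.1 (mem_of_single_apply_mem he ?_)
  rw [hfj, Pi.single_add, Pi.single_add]
  exact add_mem (add_mem hs ht) ha

end Staircase

section Counting

variable {d : ℕ}

lemma single_eq_single_imp {i j : Fin d} {a b : ℕ} (ha : a ≠ 0)
    (h : (Pi.single i a : Fin d → ℕ) = Pi.single j b) : i = j ∧ a = b := by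
  have h1 := congrFun h i
  by_cases hij : i = j
  · subst hij
    simpa using h1
  · simp [hij, ha] at h1

lemma single_ne_mixed {i j l : Fin d} {n a b : ℕ} (hlj : l ≠ j) (ha : a ≠ 0) (hb : b ≠ 0) :
    (Pi.single i n : Fin d → ℕ) ≠ Pi.single j a + Pi.single l b := by
  intro h
  have h1 := congrFun h j
  have h2 := congrFun h l
  by_cases hij : i = j
  · subst hij
    simp [hlj] at h2
    omega
  · simp [Ne.symm hij, hlj.symm] at h1
    omega

lemma mixed_eq_mixed_imp {j l l' : Fin d} {a a' b b' : ℕ} (hl : l ≠ j) (hb : b ≠ 0)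
    (h : (Pi.single j a + Pi.single l b : Fin d → ℕ) = Pi.single j a' + Pi.single l' b') :
    l = l' := by
  by_contra hll
  have := congrFun h l
  simp [hl, hll] at this
  omega

variable {S : AddSubmonoid (Fin d → ℕ)} {A : Finset (Fin d → ℕ)}

/-- If two unit vectors are gaps, `2d+1` generators are only possible for `d = 2`, where
the only generator off the axes is `e_1 + e_2`. -/
lemma generators_of_two_unit_gaps (hd : 2 ≤ d) (hfin : {x : Fin d → ℕ | x ∉ S}.Finite)
    (hgen : AddSubmonoid.closure (A : Set (Fin d → ℕ)) = S) (hcard : A.card = 2 * d + 1)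
    {j k : Fin d} (hjk : j ≠ k) (hj : (Pi.single j 1 : Fin d → ℕ) ∉ S)
    (hk : (Pi.single k 1 : Fin d → ℕ) ∉ S) :
    d = 2 ∧ ∀ a ∈ A, (∃ i n, a = Pi.single i n) ∨ a = Pi.single j 1 + Pi.single k 1 := by
  choose α hα0 hαA using exists_axis_generator hfin hgen
  have hsecond : ∀ i, (Pi.single i 1 : Fin d → ℕ) ∉ S →
      ∃ v, v ≠ 0 ∧ α i ≠ v ∧ (Pi.single i v : Fin d → ℕ) ∈ A := by
    intro i hi
    obtain ⟨u, v, hu, hv, huv, huA, hvA⟩ := exists_two_axis_generators hfin hgen hi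
    by_cases h : α i = u
    · exact ⟨v, hv, by omega, hvA⟩
    · exact ⟨u, hu, h, huA⟩
  obtain ⟨b, hb0, hbα, hbA⟩ := hsecond j hj
  obtain ⟨c, hc0, hcα, hcA⟩ := hsecond k hk
  choose γ hγ0 hγA using fun (i : Fin d) (hi : i ≠ j) => exists_mixed_generator hfin hgen hi hj
  choose δ hδ0 hδA using fun (i : Fin d) (hi : i ≠ k) => exists_mixed_generator hfin hgen hi hk
  simp only [Finset.mem_coe] at hαA hbA hcA hγA hδA
  let B₁ : Finset (Fin d → ℕ) := Finset.univ.image fun i => Pi.single i (α i)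
  let B₂ : Finset (Fin d → ℕ) := {Pi.single j b, Pi.single k c}
  let B₃ : Finset (Fin d → ℕ) := (Finset.univ.erase j).attach.image fun i =>
    Pi.single j 1 + Pi.single i.1 (γ i.1 (Finset.ne_of_mem_erase i.2))
  let B₄ : Finset (Fin d → ℕ) := ((Finset.univ.erase k).erase j).attach.image fun i =>
    Pi.single k 1 + Pi.single i.1 (δ i.1 (Finset.ne_of_mem_erase (Finset.mem_of_mem_erase i.2)))
  have hB₁ : ∀ x, x ∈ B₁ ↔ ∃ i, Pi.single i (α i) = x := by simp [B₁]
  have hB₂ : ∀ x, x ∈ B₂ ↔ x = Pi.single j b ∨ x = Pi.single k c := by simp [B₂]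
  have hB₃ : ∀ x, x ∈ B₃ ↔ ∃ i, ∃ hi : i ≠ j, Pi.single j 1 + Pi.single i (γ i hi) = x := by
    simp [B₃]
  have hB₄ : ∀ x, x ∈ B₄ ↔ ∃ i, ∃ hi : i ≠ k, i ≠ j ∧
      Pi.single k 1 + Pi.single i (δ i hi) = x := by
    intro x
    simp only [B₄, Finset.mem_image, Finset.mem_attach, true_and, Subtype.exists,
      Finset.mem_erase, Finset.mem_univ, and_true]
    exact ⟨fun ⟨i, hi, h⟩ => ⟨i, hi.2, hi.1, h⟩, fun ⟨i, hi, hij, h⟩ => ⟨i, ⟨hij, hi⟩, h⟩⟩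
  have hc₁ : B₁.card = d := by
    rw [Finset.card_image_of_injective, Finset.card_univ, Fintype.card_fin]
    intro i i' h
    exact (single_eq_single_imp (hα0 i) h).1
  have hc₂ : B₂.card = 2 := Finset.card_pair fun h => hjk (single_eq_single_imp hb0 h).1
  have hc₃ : B₃.card = d - 1 := by
    rw [Finset.card_image_of_injective, Finset.card_attach, Finset.card_erase_of_mem (by simp),
      Finset.card_univ, Fintype.card_fin]
    rintro ⟨i, hi⟩ ⟨i', hi'⟩ h
    exact Subtype.ext (mixed_eq_mixed_imp (Finset.ne_of_mem_erase hi) (hγ0 _ _) h)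
  have hc₄ : B₄.card = d - 1 - 1 := by
    rw [Finset.card_image_of_injective, Finset.card_attach,
      Finset.card_erase_of_mem (by simp [hjk]), Finset.card_erase_of_mem (by simp),
      Finset.card_univ, Fintype.card_fin]
    rintro ⟨i, hi⟩ ⟨i', hi'⟩ h
    exact Subtype.ext (mixed_eq_mixed_imp (Finset.ne_of_mem_erase (Finset.mem_of_mem_erase hi))
      (hδ0 _ _) h)
  have hd₁₂ : Disjoint B₁ B₂ := by
    rw [Finset.disjoint_left]
    intro x h1 h2
    obtain ⟨i, rfl⟩ := (hB₁ _).1 h1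
    rcases (hB₂ _).1 h2 with h | h
    · obtain ⟨rfl, h'⟩ := single_eq_single_imp (hα0 i) h
      exact hbα h'
    · obtain ⟨rfl, h'⟩ := single_eq_single_imp (hα0 i) h
      exact hcα h'
  have haxis : ∀ x ∈ B₁ ∪ B₂, ∃ i n, x = Pi.single i n := by
    intro x hx
    rcases Finset.mem_union.1 hx with hx | hx
    · obtain ⟨i, rfl⟩ := (hB₁ _).1 hx
      exact ⟨i, _, rfl⟩
    · rcases (hB₂ _).1 hx with h | h
      · exact ⟨_, _, h⟩
      · exact ⟨_, _, h⟩
  have hd₃ : Disjoint (B₁ ∪ B₂) B₃ := by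
    rw [Finset.disjoint_left]
    intro x h1 h2
    obtain ⟨i, n, rfl⟩ := haxis x h1
    obtain ⟨l, hl, h⟩ := (hB₃ _).1 h2
    exact single_ne_mixed hl one_ne_zero (hγ0 _ _) h.symm
  have hd₄ : Disjoint (B₁ ∪ B₂ ∪ B₃) B₄ := by
    rw [Finset.disjoint_left]
    intro x h1 h2
    obtain ⟨l, hl, hlj, h⟩ := (hB₄ _).1 h2
    rcases Finset.mem_union.1 h1 with h1 | h1
    · obtain ⟨i, n, rfl⟩ := haxis x h1
      exact single_ne_mixed hl one_ne_zero (hδ0 _ _) h.symm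
    · obtain ⟨i, hi, rfl⟩ := (hB₃ _).1 h1
      have := congrFun h j
      simp [hjk, hlj.symm] at this
      omega
  have hsub : B₁ ∪ B₂ ∪ B₃ ∪ B₄ ⊆ A := by
    intro x hx
    simp only [Finset.mem_union, hB₁, hB₂, hB₃, hB₄] at hx
    rcases hx with ((⟨i, rfl⟩ | rfl | rfl) | ⟨i, hi, rfl⟩) | ⟨i, hi, -, rfl⟩
    · exact hαA i
    · exact hbA
    · exact hcA
    · exact hγA i hi
    · exact hδA i hi
  have hcB : (B₁ ∪ B₂ ∪ B₃ ∪ B₄).card = d + 2 + (d - 1) + (d - 1 - 1) := by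
    rw [Finset.card_union_of_disjoint hd₄, Finset.card_union_of_disjoint hd₃,
      Finset.card_union_of_disjoint hd₁₂, hc₁, hc₂, hc₃, hc₄]
  have hle := Finset.card_le_card hsub
  have hd2 : d = 2 := by omega
  refine ⟨hd2, ?_⟩
  have hBA := Finset.eq_of_subset_of_card_le hsub (by omega)
  have honly : ∀ i, i ≠ j → i = k := by
    intro i hi
    subst hd2
    omega
  have hB₄' : ∀ x, x ∉ B₄ := by
    intro x hx
    obtain ⟨i, hi, hij, -⟩ := (hB₄ _).1 hx
    exact hi (honly i hij)
  have hmix : ∀ x ∈ A, (∃ i n, x = Pi.single i n) ∨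
      x = Pi.single j 1 + Pi.single k (γ k hjk.symm) := by
    intro x hx
    rw [← hBA] at hx
    rcases Finset.mem_union.1 hx with hx | hx
    · rcases Finset.mem_union.1 hx with hx | hx
      · exact Or.inl (haxis x hx)
      · obtain ⟨i, hi, rfl⟩ := (hB₃ _).1 hx
        obtain rfl := honly i hi
        exact Or.inr rfl
    · exact absurd hx (hB₄' x)
  have hγ1 : γ k hjk.symm = 1 := by
    rcases hmix _ (hδA j hjk) with ⟨i, n, h⟩ | h
    · exact absurd h.symm (single_ne_mixed hjk one_ne_zero (hδ0 _ _))
    · have := congrFun h k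
      simp [hjk.symm] at this
      exact this.symm
  rw [hγ1] at hmix
  exact hmix

/-- If `e_j` is the only unit vector that is a gap and there are `2d+1` generators, then either
the generators off the `j`-th axis are as few as possible or exactly two lie on this axis. -/
lemma generators_of_one_unit_gap (hfin : {x : Fin d → ℕ | x ∉ S}.Finite)
    (hgen : AddSubmonoid.closure (A : Set (Fin d → ℕ)) = S) (hcard : A.card = 2 * d + 1)
    {j : Fin d} (hj : (Pi.single j 1 : Fin d → ℕ) ∉ S)
    (he : ∀ i, i ≠ j → (Pi.single i 1 : Fin d → ℕ) ∈ S) :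
    (∃ m : Fin d → ℕ, (∀ i, i ≠ j → m i ≠ 0) ∧
      (∀ i, i ≠ j → (Pi.single j 1 + Pi.single i (m i) : Fin d → ℕ) ∈ A) ∧
      ∀ a ∈ A, (∃ n, a = Pi.single j n) ∨
        ∃ i, i ≠ j ∧ (a = Pi.single i 1 ∨ a = Pi.single j 1 + Pi.single i (m i))) ∨
    ∃ u v, {n : ℕ | (Pi.single j n : Fin d → ℕ) ∈ A} = {u, v} := by
  have heA : ∀ i, i ≠ j → (Pi.single i 1 : Fin d → ℕ) ∈ A := fun i hi =>
    single_one_mem_generators (A := (A : Set (Fin d → ℕ))) (hgen ▸ he i hi)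
  have hmix : ∀ i, ∃ n, i ≠ j → n ≠ 0 ∧ (Pi.single j 1 + Pi.single i n : Fin d → ℕ) ∈ A := by
    intro i
    by_cases hi : i = j
    · exact ⟨0, fun h => absurd hi h⟩
    · obtain ⟨n, hn, hnA⟩ := exists_mixed_generator hfin hgen hi hj
      exact ⟨n, fun _ => ⟨hn, hnA⟩⟩
  choose m hm using hmix
  obtain ⟨u, v, hu, hv, huv, huA, hvA⟩ := exists_two_axis_generators hfin hgen hj
  rw [Finset.mem_coe] at huA hvA
  refine or_iff_not_imp_left.2 fun hnot => ⟨u, v, ?_⟩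
  obtain ⟨w, hwA, hw⟩ : ∃ w ∈ A, ¬ ((∃ n, w = Pi.single j n) ∨
      ∃ i, i ≠ j ∧ (w = Pi.single i 1 ∨ w = Pi.single j 1 + Pi.single i (m i))) := by
    by_contra! h
    exact hnot ⟨m, fun i hi => (hm i hi).1, fun i hi => (hm i hi).2, h⟩
  let B₁ : Finset (Fin d → ℕ) := (Finset.univ.erase j).image fun i => Pi.single i 1
  let B₂ : Finset (Fin d → ℕ) :=
    (Finset.univ.erase j).image fun i => Pi.single j 1 + Pi.single i (m i)
  let B₃ : Finset (Fin d → ℕ) := {Pi.single j u, Pi.single j v}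
  have hB₁ : ∀ x, x ∈ B₁ ↔ ∃ i, i ≠ j ∧ Pi.single i 1 = x := by simp [B₁]
  have hB₂ : ∀ x, x ∈ B₂ ↔ ∃ i, i ≠ j ∧ Pi.single j 1 + Pi.single i (m i) = x := by simp [B₂]
  have hB₃ : ∀ x, x ∈ B₃ ↔ x = Pi.single j u ∨ x = Pi.single j v := by simp [B₃]
  have hc₁ : B₁.card = d - 1 := by
    rw [Finset.card_image_of_injective, Finset.card_erase_of_mem (by simp),
      Finset.card_univ, Fintype.card_fin]
    intro i i' h
    exact (single_eq_single_imp one_ne_zero h).1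
  have hc₂ : B₂.card = d - 1 := by
    rw [Finset.card_image_of_injOn, Finset.card_erase_of_mem (by simp),
      Finset.card_univ, Fintype.card_fin]
    intro i hi i' hi' h
    have hij : i ≠ j := Finset.ne_of_mem_erase hi
    exact mixed_eq_mixed_imp hij (hm i hij).1 h
  have hc₃ : B₃.card = 2 := Finset.card_pair fun h => huv (single_eq_single_imp hu h).2
  have hd₁₂ : Disjoint B₁ B₂ := by
    rw [Finset.disjoint_left]
    intro x h1 h2
    obtain ⟨i, hi, rfl⟩ := (hB₁ _).1 h1
    obtain ⟨l, hl, h⟩ := (hB₂ _).1 h2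
    exact single_ne_mixed hl one_ne_zero (hm l hl).1 h.symm
  have hoff : ∀ n, Pi.single j n ∉ B₁ ∪ B₂ := by
    intro n h1
    rcases Finset.mem_union.1 h1 with h1 | h1
    · obtain ⟨i, hi, h⟩ := (hB₁ _).1 h1
      exact hi (single_eq_single_imp one_ne_zero h).1
    · obtain ⟨i, hi, h⟩ := (hB₂ _).1 h1
      exact single_ne_mixed hi one_ne_zero (hm i hi).1 h.symm
  have hd₃ : Disjoint (B₁ ∪ B₂) B₃ := by
    rw [Finset.disjoint_right]
    intro x h1
    rcases (hB₃ _).1 h1 with rfl | rfl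
    · exact hoff u
    · exact hoff v
  have hwB : w ∉ B₁ ∪ B₂ ∪ B₃ := by
    simp only [Finset.mem_union, hB₁, hB₂, hB₃]
    rintro ((⟨i, hi, rfl⟩ | ⟨i, hi, rfl⟩) | rfl | rfl)
    · exact hw (Or.inr ⟨i, hi, Or.inl rfl⟩)
    · exact hw (Or.inr ⟨i, hi, Or.inr rfl⟩)
    · exact hw (Or.inl ⟨_, rfl⟩)
    · exact hw (Or.inl ⟨_, rfl⟩)
  have hsub : insert w (B₁ ∪ B₂ ∪ B₃) ⊆ A := by
    intro x hx
    simp only [Finset.mem_insert, Finset.mem_union, hB₁, hB₂, hB₃] at hx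
    rcases hx with rfl | (⟨i, hi, rfl⟩ | ⟨i, hi, rfl⟩) | rfl | rfl
    · exact hwA
    · exact heA i hi
    · exact (hm i hi).2
    · exact huA
    · exact hvA
  have hcB : (insert w (B₁ ∪ B₂ ∪ B₃)).card = d - 1 + (d - 1) + 2 + 1 := by
    rw [Finset.card_insert_of_notMem hwB, Finset.card_union_of_disjoint hd₃,
      Finset.card_union_of_disjoint hd₁₂, hc₁, hc₂, hc₃]
  have hdpos : 0 < d := j.pos
  have hBA := Finset.eq_of_subset_of_card_le hsub (by omega)
  ext n
  simp only [Set.mem_ofPred_eq, Set.mem_insert_iff, Set.mem_singleton_iff]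
  constructor
  · intro hn
    rw [← hBA] at hn
    rcases Finset.mem_insert.1 hn with hn | hn
    · exact absurd (Or.inl ⟨n, hn.symm⟩) hw
    · rcases Finset.mem_union.1 hn with hn | hn
      · exact absurd hn (hoff n)
      · simpa using (hB₃ _).1 hn
  · rintro (rfl | rfl)
    · exact huA
    · exact hvA

/-- If all generators are on the axes or equal to `e_j + e_k`, and `e_k` is a gap, then the
`j`-th coordinate of an upper bound of the gaps lies in `S`. -/
lemma single_apply_mem_of_axis_or_diagonal
    (hgen : AddSubmonoid.closure (A : Set (Fin d → ℕ)) = S) {j k : Fin d} (hjk : j ≠ k)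
    (hA : ∀ a ∈ A, (∃ i n, a = Pi.single i n) ∨ a = Pi.single j 1 + Pi.single k 1)
    (hk : (Pi.single k 1 : Fin d → ℕ) ∉ S) {f : Fin d → ℕ} (hle : ∀ x, x ∉ S → x ≤ f) :
    (Pi.single j (f j) : Fin d → ℕ) ∈ S := by
  by_contra hf
  have hgap : (Pi.single j (f j + 1) + Pi.single k 1 : Fin d → ℕ) ∉ S := by
    intro h
    rw [← hgen] at h
    obtain ⟨a, ha, hak, y, hy, hxy⟩ :=
      exists_generator_of_apply_eq_one h (j := k) (by simp [hjk.symm])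
    rw [hgen] at hy
    rcases hA a ha with ⟨i, n, rfl⟩ | rfl
    · by_cases hik : i = k
      · subst hik
        simp at hak
        subst hak
        exact hk (hgen ▸ AddSubmonoid.subset_closure ha)
      · simp [Ne.symm hik] at hak
    · rw [Pi.single_add, add_assoc, add_comm] at hxy
      exact hf (add_left_cancel hxy ▸ hy)
  have := hle _ hgap j
  simp [hjk] at this

end Counting

/-- an almost symmetric GNS in ℕ^d (d ≥ 2) of embedding dimension 2d+1
has type at most 2; in fact its type equals 1. -/
theorem type_of_almost_symmetric_edim_2d_plus_1
    (d : ℕ) (hd : 2 ≤ d)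
    (S : AddSubmonoid (Fin d → ℕ))
    (hfin : {x : Fin d → ℕ | x ∉ S}.Finite)
    (A : Finset (Fin d → ℕ))
    (hgen : AddSubmonoid.closure (A : Set (Fin d → ℕ)) = S)
    (hmin : ∀ B ⊂ A, AddSubmonoid.closure (B : Set (Fin d → ℕ)) ≠ S)
    (hcard : A.card = 2 * d + 1)
    (has : AlmostSymmetric S) :
    (PF S).ncard ≤ 2 ∧ (PF S).ncard = 1 := by
  obtain ⟨f, hFA, hsymm⟩ := has
  have hfFA : f ∈ FA S := hFA ▸ Set.mem_singleton f
  have hfPF := mem_PF_of_mem_FA hfFA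
  have hle : ∀ x, x ∉ S → x ≤ f := fun x hx => gap_le_of_FA_eq_singleton hfin hFA hx
  have hPF : PF S = {f} := by
    refine Set.eq_singleton_iff_unique_mem.2 ⟨hfPF, fun p hp => ?_⟩
    by_contra hpf
    have hq := hsymm p hp hpf
    have hpq : p + (f - p) = f := add_tsub_cancel_of_le (hle p hp.1)
    obtain ⟨j, hj⟩ : ∃ j, (Pi.single j 1 : Fin d → ℕ) ∉ S := by
      by_contra! h
      exact hfFA.1 (mem_of_forall_single_mem fun i => single_mem_of_single_one_mem (h i) _)
    by_cases he : ∀ i, i ≠ j → (Pi.single i 1 : Fin d → ℕ) ∈ S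
    · rcases generators_of_one_unit_gap hfin hgen hcard hj he with
        ⟨m, hm, hmix, hA⟩ | ⟨u, v, huv⟩
      · obtain ⟨a, ha0, ha⟩ := exists_axis_generator hfin hgen j
        have : Nontrivial (Fin d) := Fin.nontrivial_iff_two_le.2 hd
        obtain ⟨i₀, hi₀⟩ := exists_ne j
        exact false_of_staircase
          (mem_iff_level hgen he hm
            (fun i hi => hgen ▸ AddSubmonoid.subset_closure (hmix i hi)) hA)
          he hj ⟨a, ha0, hgen ▸ AddSubmonoid.subset_closure ha⟩ hi₀ hle hfPF hp hq hpq
      · exact false_of_two_axis_generators hgen he huv hle hfFA.1 hp.1 hq.1 hpq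
    · push Not at he
      obtain ⟨k, hkj, hk⟩ := he
      obtain ⟨rfl, hA⟩ := generators_of_two_unit_gaps hd hfin hgen hcard hkj.symm hj hk
      have h1 := single_apply_mem_of_axis_or_diagonal hgen hkj.symm hA hk hle
      have h2 := single_apply_mem_of_axis_or_diagonal hgen hkj
        (fun a ha => by rw [add_comm]; exact hA a ha) hj hle
      refine hfFA.1 (mem_of_forall_single_mem fun i => ?_)
      obtain rfl | rfl : i = j ∨ i = k := by omega
      · exact h1
      · exact h2
  rw [hPF, Set.ncard_singleton]
  exact ⟨one_le_two, rfl⟩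
end
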